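/- (Analytic core of the Main Theorem) Let (M, μ) be a measure space, let N : M → (0, ∞) be measurable with pushforward measure N_*μ equal to W·(dt/t) on (0, ∞) for some constant 0 < W < ∞, let c > 0, and let τ : M → M be a measurable, measure-preserving involution with N(τx) = c²/N(x) for all x ∈ M. Let h : M → [1, ∞) be measurable with h(x) = h(τx)·N(x)/c for all x ∈ M, and let A > 0 be a real number such that ∫_{{x : N(x) ≤ c}} (h(x)^A − 1)·N(x)^{−σ} dμ(x) < ∞ for every σ ∈ ℝ. Then the integral Z(s) := c^s ∫_M (h(x)^A − 1)·N(x)^{−s} dμ(x) converges absolutely for Re(s) > A and defines a holomorphic function there; Z extends to a meromorphic function on all of ℂ, holomorphic except for simple poles at s = 0 and s = A with residues −W and W respectively; and Z satisfies the functional equation Z(s) = Z(A − s). Explicitly, Z(s) = E(s) + E(A − s) + W/(s − A) − W/s, where E(s) := c^s ∫_{{x : N(x) ≤ c}} (h(x)^A − 1)·N(x)^{−s} dμ(x) is entire. -/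

import Mathlib

/- **Statement 16.** The analytic core of the Main Theorem on the rank-`r` non-abelian zeta
function `Z_{F,r;A}(s) = |Δ_F|^{rs/2} ∫_{M}(h(x)^A − 1) N(x)^{−s} dμ(x)`:
abstract setting of a measure space `(M, μ)`, a "norm" `N` with pushforward `W·dt/t` on
`(0,∞)`, a measure-preserving Serre-duality involution `τ` with `N(τx) = c²/N(x)` and
`h = (h∘τ)·N/c` (multiplicative Riemann–Roch), and `A > 0`. -/

open MeasureTheory Complex Filter Topology

noncomputable section

namespace WengRRZeta

/-- The entire part `E(s) := c^s ∫_{N(x) ≤ c} (h(x)^A − 1) N(x)^{−s} dμ(x)`. -/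
def zetaE {M : Type*} [MeasurableSpace M] (μ : Measure M) (N : M → ℝ) (h : M → ℝ)
    (c A : ℝ) : ℂ → ℂ := fun s =>
  (c : ℂ) ^ s * ∫ x in {x | N x ≤ c}, ((h x ^ A - 1 : ℝ) : ℂ) * (N x : ℂ) ^ (-s) ∂μ

/-- The meromorphic continuation `G(s) := E(s) + E(A − s) + W/(s − A) − W/s`. -/
def zetaG {M : Type*} [MeasurableSpace M] (μ : Measure M) (N : M → ℝ) (h : M → ℝ)
    (c A W : ℝ) : ℂ → ℂ := fun s =>
  zetaE μ N h c A s + zetaE μ N h c A ((A : ℂ) - s) + (W : ℂ) / (s - A) - (W : ℂ) / s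

lemma ofReal_cpow_eq_cexp {t : ℝ} (ht : 0 < t) (w : ℂ) :
    (t : ℂ) ^ w = cexp (Real.log t * w) := by
  rw [cpow_def_of_ne_zero (by exact_mod_cast ht.ne'), ofReal_log ht.le]

section Integrals

variable {M : Type*} [MeasurableSpace M] {μ : Measure M} {N f : M → ℝ}

lemma integrable_mul_cpow (hN : Measurable N) (hNpos : ∀ x, 0 < N x) (hf : Measurable f)
    {s : ℂ} (hint : Integrable (fun x => f x * N x ^ (-s.re)) μ) :
    Integrable (fun x => (f x : ℂ) * (N x : ℂ) ^ (-s)) μ := by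
  refine hint.mono (Measurable.aestronglyMeasurable (by fun_prop)) (ae_of_all _ fun x => ?_)
  rw [norm_mul, norm_mul, norm_cpow_eq_rpow_re_of_pos (hNpos x), norm_real, neg_re,
    Real.norm_of_nonneg (Real.rpow_nonneg (hNpos x).le _)]

/-- A Mellin-type integral that converges for all real exponents is entire. -/
lemma differentiable_integral_mul_cpow (hNpos : ∀ x, 0 < N x)
    (hf : Measurable f) (hf0 : ∀ x, 0 ≤ f x)
    (hint : ∀ σ : ℝ, Integrable (fun x => f x * N x ^ (-σ)) μ) :
    Differentiable ℂ (fun s : ℂ => ∫ x, (f x : ℂ) * (N x : ℂ) ^ (-s) ∂μ) := by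
  set ν := μ.withDensity fun x => ENNReal.ofReal (f x)
  have hdens : Measurable fun x => ENNReal.ofReal (f x) := by fun_prop
  have htop : ∀ᵐ x ∂μ, ENNReal.ofReal (f x) < ⊤ := ae_of_all _ fun _ => ENNReal.ofReal_lt_top
  have hset : ProbabilityTheory.integrableExpSet (fun x => -Real.log (N x)) ν = Set.univ := by
    refine Set.eq_univ_of_forall fun σ => ?_
    refine (integrable_withDensity_iff_integrable_smul' hdens htop).2 ((hint σ).congr ?_)
    refine ae_of_all _ fun x => ?_
    simp only [smul_eq_mul, ENNReal.toReal_ofReal (hf0 x), Real.rpow_def_of_pos (hNpos x)]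
    ring_nf
  have hmgf : ProbabilityTheory.complexMGF (fun x => -Real.log (N x)) ν =
      fun s : ℂ => ∫ x, (f x : ℂ) * (N x : ℂ) ^ (-s) ∂μ := by
    ext s
    rw [ProbabilityTheory.complexMGF, integral_withDensity_eq_integral_toReal_smul hdens htop]
    refine integral_congr_ae (ae_of_all _ fun x => ?_)
    simp only [ENNReal.toReal_ofReal (hf0 x), real_smul, ofReal_cpow_eq_cexp (hNpos x)]
    push_cast
    ring_nf
  rw [← hmgf, ← differentiableOn_univ]
  refine ProbabilityTheory.differentiableOn_complexMGF.mono ?_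
  simp [hset]

variable {W c : ℝ}

lemma map_restrict_lt (hN : Measurable N)
    (hpush : Measure.map N μ =
      (ENNReal.ofReal W) •
        ((volume.restrict (Set.Ioi (0 : ℝ))).withDensity fun t => ENNReal.ofReal t⁻¹)) :
    Measure.map N (μ.restrict {x | N x < c}) =
      (ENNReal.ofReal W) •
        ((volume.restrict (Set.Ioo 0 c)).withDensity fun t => ENNReal.ofReal t⁻¹) := by
  have h := Measure.restrict_map (μ := μ) hN (measurableSet_Iio (a := c))
  rw [hpush, Measure.restrict_smul, restrict_withDensity measurableSet_Iio,
    Measure.restrict_restrict measurableSet_Iio, Set.inter_comm, Set.Ioi_inter_Iio] at h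
  exact h.symm

lemma measure_level_eq_zero (hN : Measurable N)
    (hpush : Measure.map N μ =
      (ENNReal.ofReal W) •
        ((volume.restrict (Set.Ioi (0 : ℝ))).withDensity fun t => ENNReal.ofReal t⁻¹)) :
    μ {x | N x = c} = 0 := by
  have h : Measure.map N μ {c} = 0 := by
    rw [hpush, Measure.smul_apply,
      withDensity_absolutelyContinuous _ _ (measure_singleton c), smul_zero]
  rwa [Measure.map_apply hN (measurableSet_singleton c)] at h

lemma integrableOn_lt_cpow (hN : Measurable N)
    (hpush : Measure.map N μ =
      (ENNReal.ofReal W) •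
        ((volume.restrict (Set.Ioi (0 : ℝ))).withDensity fun t => ENNReal.ofReal t⁻¹))
    {w : ℂ} (hw : 0 < w.re) :
    IntegrableOn (fun x => (N x : ℂ) ^ w) {x | N x < c} μ := by
  have hmeas : Measurable fun t : ℝ => (t : ℂ) ^ w := by fun_prop
  refine (integrable_map_measure (g := fun t : ℝ => (t : ℂ) ^ w)
    hmeas.aestronglyMeasurable hN.aemeasurable).1 ?_
  rw [map_restrict_lt hN hpush]
  refine Integrable.smul_measure ?_ ENNReal.ofReal_ne_top
  refine (integrable_withDensity_iff_integrable_smul' (by fun_prop)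
    (ae_of_all _ fun _ => ENNReal.ofReal_lt_top)).2 ?_
  have hi := (intervalIntegral.intervalIntegrable_cpow' (a := 0) (b := c) (r := w - 1)
    (by simpa using hw)).1.mono_set Set.Ioo_subset_Ioc_self
  refine hi.congr_fun (fun t ht => ?_) measurableSet_Ioo
  have ht0 : (t : ℂ) ≠ 0 := by exact_mod_cast ht.1.ne'
  simp only [ENNReal.toReal_ofReal (inv_nonneg.2 ht.1.le), real_smul, cpow_sub _ _ ht0, cpow_one,
    ofReal_inv]
  ring

lemma setIntegral_lt_cpow (hN : Measurable N) (hc : 0 < c) (hW : 0 ≤ W)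
    (hpush : Measure.map N μ =
      (ENNReal.ofReal W) •
        ((volume.restrict (Set.Ioi (0 : ℝ))).withDensity fun t => ENNReal.ofReal t⁻¹))
    {w : ℂ} (hw : 0 < w.re) :
    ∫ x in {x | N x < c}, (N x : ℂ) ^ w ∂μ = W * (c : ℂ) ^ w / w := by
  have hmeas : Measurable fun t : ℝ => (t : ℂ) ^ w := by fun_prop
  have hw0 : w ≠ 0 := by rintro rfl; simp at hw
  have hcpow : ∫ t in Set.Ioo 0 c, (t : ℂ) ^ (w - 1) = (c : ℂ) ^ w / w := by
    rw [← integral_Ioc_eq_integral_Ioo, ← intervalIntegral.integral_of_le hc.le,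
      integral_cpow (Or.inl (by simpa using hw))]
    simp [hw0]
  rw [← integral_map (f := fun t : ℝ => (t : ℂ) ^ w) hN.aemeasurable hmeas.aestronglyMeasurable,
    map_restrict_lt hN hpush, integral_smul_measure,
    integral_withDensity_eq_integral_toReal_smul (by fun_prop)
      (ae_of_all _ fun _ => ENNReal.ofReal_lt_top),
    ENNReal.toReal_ofReal hW, real_smul, mul_div_assoc, ← hcpow]
  congr 1
  refine setIntegral_congr_fun measurableSet_Ioo fun t ht => ?_
  have ht0 : (t : ℂ) ≠ 0 := by exact_mod_cast ht.1.ne'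
  simp only [ENNReal.toReal_ofReal (inv_nonneg.2 ht.1.le), real_smul, cpow_sub _ _ ht0, cpow_one,
    ofReal_inv]
  ring

end Integrals

/-- The effect of the Riemann–Roch relation on the integrand of the zeta function. -/
lemma integrand_reflection {c n a : ℝ} (hc : 0 < c) (hn : 0 < n) (ha : 0 < a) (A : ℝ) (s : ℂ) :
    (c : ℂ) ^ s * ((((a * (c ^ 2 / n) / c) ^ A - 1 : ℝ) : ℂ) * ((c ^ 2 / n : ℝ) : ℂ) ^ (-s)) =
      (c : ℂ) ^ (A - s) * (((a ^ A - 1 : ℝ) : ℂ) * (n : ℂ) ^ (-(A - s))) +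
        ((c : ℂ) ^ (A - s) * (n : ℂ) ^ (s - A) - (c : ℂ) ^ (-s) * (n : ℂ) ^ s) := by
  have hdiv : a * (c ^ 2 / n) / c = a * (c / n) := by field_simp
  rw [hdiv, Real.mul_rpow ha.le (by positivity), Real.rpow_def_of_pos (div_pos hc hn),
    Real.log_div hc.ne' hn.ne', ofReal_cpow_eq_cexp (t := c ^ 2 / n) (by positivity),
    Real.log_div (by positivity) hn.ne', Real.log_pow]
  simp only [ofReal_cpow_eq_cexp hc, ofReal_cpow_eq_cexp hn]
  push_cast
  generalize ((Real.log c : ℝ) : ℂ) = l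
  generalize ((Real.log n : ℝ) : ℂ) = L
  generalize ((a ^ A : ℝ) : ℂ) = H
  have e1 : cexp (l * s) * cexp ((2 * l - L) * -s) = cexp (-l * s + L * s) := by
    rw [← Complex.exp_add]; ring_nf
  have e2 : cexp (l * s) * cexp ((l - L) * A) * cexp ((2 * l - L) * -s) =
      cexp ((l - L) * (A - s)) := by
    rw [← Complex.exp_add, ← Complex.exp_add]; ring_nf
  have e3 : cexp (l * (A - s)) * cexp (L * -(A - s)) = cexp ((l - L) * (A - s)) := by
    rw [← Complex.exp_add]; ring_nf
  have e4 : cexp (l * (A - s)) * cexp (L * (s - A)) = cexp ((l - L) * (A - s)) := by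
    rw [← Complex.exp_add]; ring_nf
  have e5 : cexp (l * -s) * cexp (L * s) = cexp (-l * s + L * s) := by
    rw [← Complex.exp_add]; ring_nf
  linear_combination H * e2 - e1 - (H - 1) * e3 - e4 + e5

lemma tendsto_mul_add_div {F : ℂ → ℂ} {a : ℂ} (hF : ContinuousAt F a) (w : ℂ) :
    Tendsto (fun s => (s - a) * (F s + w / (s - a))) (𝓝[≠] a) (𝓝 w) := by
  have hcont : Tendsto (fun s => (s - a) * F s + w) (𝓝 a) (𝓝 w) := by
    have h : ContinuousAt (fun s => (s - a) * F s + w) a := by fun_prop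
    simpa [ContinuousAt] using h
  refine (hcont.mono_left nhdsWithin_le_nhds).congr' ?_
  filter_upwards [self_mem_nhdsWithin] with s hs
  have : s - a ≠ 0 := sub_ne_zero.2 hs
  field_simp

/-- analytic core of the Main Theorem.  Under the stated hypotheses, the
integral `Z(s) := c^s ∫_M (h^A − 1) N^{−s} dμ` converges absolutely and is holomorphic on
`Re s > A`; it agrees there with `G(s) = E(s) + E(A−s) + W/(s−A) − W/s`, where `E` is entire;
`G` is holomorphic away from `{0, A}`, has simple poles at `0` and `A` with residues `−W`
and `W`, and satisfies the functional equation `G(s) = G(A − s)`. -/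
theorem zeta_analytic_core
    {M : Type*} [MeasurableSpace M] (μ : Measure M)
    (N : M → ℝ) (hNmeas : Measurable N) (hNpos : ∀ x, 0 < N x)
    (W : ℝ) (hW : 0 < W)
    (hpush : Measure.map N μ =
      (ENNReal.ofReal W) •
        ((volume.restrict (Set.Ioi (0 : ℝ))).withDensity fun t => ENNReal.ofReal t⁻¹))
    (c : ℝ) (hc : 0 < c)
    (τ : M → M) (hτmeas : Measurable τ) (hτinv : Function.Involutive τ)
    (hτpres : Measure.map τ μ = μ) (hτN : ∀ x, N (τ x) = c ^ 2 / N x)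
    (h : M → ℝ) (hhmeas : Measurable h) (hh1 : ∀ x, 1 ≤ h x)
    (hRR : ∀ x, h x = h (τ x) * N x / c)
    (A : ℝ) (hA : 0 < A)
    (hint : ∀ σ : ℝ, IntegrableOn (fun x => (h x ^ A - 1) * N x ^ (-σ)) {x | N x ≤ c} μ) :
    (∀ s : ℂ, A < s.re →
      Integrable (fun x => ((h x ^ A - 1 : ℝ) : ℂ) * (N x : ℂ) ^ (-s)) μ) ∧
    DifferentiableOn ℂ
      (fun s : ℂ => (c : ℂ) ^ s * ∫ x, ((h x ^ A - 1 : ℝ) : ℂ) * (N x : ℂ) ^ (-s) ∂μ)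
      {s : ℂ | A < s.re} ∧
    (∀ s : ℂ, A < s.re →
      (c : ℂ) ^ s * ∫ x, ((h x ^ A - 1 : ℝ) : ℂ) * (N x : ℂ) ^ (-s) ∂μ =
        zetaG μ N h c A W s) ∧
    Differentiable ℂ (zetaE μ N h c A) ∧
    DifferentiableOn ℂ (zetaG μ N h c A W) ({0, (A : ℂ)} : Set ℂ)ᶜ ∧
    (∀ s : ℂ, zetaG μ N h c A W s = zetaG μ N h c A W ((A : ℂ) - s)) ∧
    Tendsto (fun s : ℂ => s * zetaG μ N h c A W s) (𝓝[≠] 0) (𝓝 (-(W : ℂ))) ∧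
    Tendsto (fun s : ℂ => (s - (A : ℂ)) * zetaG μ N h c A W s) (𝓝[≠] (A : ℂ)) (𝓝 (W : ℂ)) := by
  have hfmeas : Measurable fun x => h x ^ A - 1 := by fun_prop
  have hf0 : ∀ x, 0 ≤ h x ^ A - 1 := fun x =>
    sub_nonneg.2 (Real.one_le_rpow (hh1 x) hA.le)
  have hcs : ∀ s : ℂ, (c : ℂ) ^ s ≠ 0 := fun s => by simp [cpow_eq_zero_iff, hc.ne']
  have hE : Differentiable ℂ (zetaE μ N h c A) :=
    (differentiable_id.const_cpow (Or.inl (by exact_mod_cast hc.ne'))).mul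
      (differentiable_integral_mul_cpow hNpos hfmeas hf0 hint)
  have hE' : Differentiable ℂ fun s : ℂ => zetaE μ N h c A ((A : ℂ) - s) :=
    hE.comp (differentiable_id.const_sub _)
  have hG : DifferentiableOn ℂ (zetaG μ N h c A W) ({0, (A : ℂ)} : Set ℂ)ᶜ := by
    intro s hs
    simp only [Set.mem_compl_iff, Set.mem_insert_iff, Set.mem_singleton_iff, not_or] at hs
    have hsA : s - A ≠ 0 := sub_ne_zero.2 hs.2
    refine DifferentiableAt.differentiableWithinAt ?_
    exact (((hE s).add (hE' s)).add ((differentiableAt_const _).div (by fun_prop) hsA)).sub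
      ((differentiableAt_const _).div differentiableAt_id hs.1)
  set g : ℂ → M → ℂ := fun s x =>
    (c : ℂ) ^ s * (((h x ^ A - 1 : ℝ) : ℂ) * (N x : ℂ) ^ (-s)) with hg
  have hgle : ∀ s : ℂ, IntegrableOn (g s) {x | N x ≤ c} μ := fun s =>
    (integrable_mul_cpow hNmeas hNpos hfmeas (hint s.re)).const_mul _
  have hltle : ({x | N x < c} : Set M) =ᵐ[μ] {x | N x ≤ c} := by
    have hnull : ∀ᵐ x ∂μ, N x ≠ c := by
      simpa [ae_iff] using measure_level_eq_zero (c := c) hNmeas hpush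
    filter_upwards [hnull] with x hx
    exact propext ⟨le_of_lt, fun hle => lt_of_le_of_ne hle hx⟩
  have hτ : MeasurePreserving τ μ μ := ⟨hτmeas, hτpres⟩
  have hτemb : MeasurableEmbedding τ :=
    (MeasurableEquiv.mk hτinv.toPerm hτmeas hτmeas).measurableEmbedding
  have hpre : τ ⁻¹' {x | N x ≤ c}ᶜ = {x | N x < c} := by
    ext x
    simp only [Set.mem_preimage, Set.mem_compl_iff, Set.mem_ofPred_eq, not_le, hτN,
      lt_div_iff₀ (hNpos x), sq, mul_lt_mul_iff_right₀ hc]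
  have hgτ : ∀ s : ℂ, g s ∘ τ = fun x => g (A - s) x +
      ((c : ℂ) ^ (A - s) * (N x : ℂ) ^ (s - A) - (c : ℂ) ^ (-s) * (N x : ℂ) ^ s) := by
    intro s
    ext x
    have hx := hRR (τ x)
    rw [hτinv x, hτN] at hx
    simp only [hg, Function.comp_apply, hx, hτN]
    exact integrand_reflection hc (hNpos x) (zero_lt_one.trans_le (hh1 x)) A s
  have hre : ∀ {s : ℂ}, A < s.re → 0 < s.re ∧ 0 < (s - A).re := fun hs =>
    ⟨hA.trans hs, by simpa using hs⟩
  have hlt : ∀ s : ℂ, IntegrableOn (g s) {x | N x < c} μ := fun s =>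
    (hgle s).congr_set_ae hltle
  have hpow : ∀ {s : ℂ}, A < s.re →
      IntegrableOn (fun x => (c : ℂ) ^ (A - s) * (N x : ℂ) ^ (s - A)) {x | N x < c} μ ∧
      IntegrableOn (fun x => (c : ℂ) ^ (-s) * (N x : ℂ) ^ s) {x | N x < c} μ := fun hs =>
    ⟨(integrableOn_lt_cpow hNmeas hpush (hre hs).2).const_mul _,
      (integrableOn_lt_cpow hNmeas hpush (hre hs).1).const_mul _⟩
  have hgint : ∀ s : ℂ, A < s.re → Integrable (g s) μ := by
    intro s hs
    rw [← integrableOn_univ, ← Set.union_compl_self {x | N x ≤ c}]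
    refine (hgle s).union ((hτ.integrableOn_comp_preimage hτemb).1 ?_)
    rw [hpre, hgτ]
    exact (hlt _).add ((hpow hs).1.sub (hpow hs).2)
  have hset : ∀ s : ℂ, ∫ x in {x | N x ≤ c}, g s x ∂μ = zetaE μ N h c A s := fun s =>
    integral_const_mul _ _
  have hZ : ∀ s : ℂ, A < s.re →
      (c : ℂ) ^ s * ∫ x, ((h x ^ A - 1 : ℝ) : ℂ) * (N x : ℂ) ^ (-s) ∂μ =
        zetaG μ N h c A W s := by
    intro s hs
    have hcompl : ∫ x in {x | N x ≤ c}ᶜ, g s x ∂μ =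
        zetaE μ N h c A (A - s) + (W / (s - A) - W / s) := by
      rw [← hτ.setIntegral_preimage_emb hτemb, hpre]
      change ∫ x in {x | N x < c}, (g s ∘ τ) x ∂μ = _
      rw [hgτ]
      refine (integral_add (hlt _) ((hpow hs).1.sub (hpow hs).2)).trans ?_
      rw [integral_sub' (hpow hs).1 (hpow hs).2, setIntegral_congr_set hltle, hset,
        integral_const_mul, integral_const_mul,
        setIntegral_lt_cpow hNmeas hc hW.le hpush (hre hs).1,
        setIntegral_lt_cpow hNmeas hc hW.le hpush (hre hs).2]
      have h1 : (c : ℂ) ^ (A - s) * (c : ℂ) ^ (s - A) = 1 := by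
        rw [← neg_sub s, cpow_neg, inv_mul_cancel₀ (hcs _)]
      have h2 : (c : ℂ) ^ (-s) * (c : ℂ) ^ s = 1 := by
        rw [cpow_neg, inv_mul_cancel₀ (hcs _)]
      linear_combination W / (s - A) * h1 - W / s * h2
    rw [← integral_const_mul]
    change ∫ x, g s x ∂μ = _
    rw [← integral_add_compl (measurableSet_le hNmeas measurable_const) (hgint s hs), hset,
      hcompl, zetaG]
    ring
  have hA0 : (A : ℂ) ≠ 0 := by exact_mod_cast hA.ne'
  refine ⟨fun s hs => ?_, ?_, hZ, hE, hG, fun s => ?_, ?_, ?_⟩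
  · simpa [hg, ← mul_assoc, hcs] using (hgint s hs).const_mul ((c : ℂ) ^ s)⁻¹
  · refine (hG.mono fun s hs => ?_).congr fun s hs => hZ s hs
    rintro (rfl | rfl)
    · exact absurd hs (by simpa using hA.le)
    · simp at hs
  · rw [zetaG, zetaG, sub_sub_cancel, sub_sub_cancel_left, ← neg_sub s, div_neg, div_neg]
    ring
  · have hF : ContinuousAt (fun s : ℂ => zetaE μ N h c A s + zetaE μ N h c A (A - s) +
        W / (s - A)) 0 :=
      ((hE 0).continuousAt.add (hE' 0).continuousAt).add
        (continuousAt_const.div (by fun_prop) (by simpa using hA0))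
    refine (tendsto_mul_add_div hF (-W)).congr fun s => ?_
    simp only [zetaG, sub_zero]
    ring
  · have hF : ContinuousAt (fun s : ℂ => zetaE μ N h c A s + zetaE μ N h c A (A - s) -
        W / s) A :=
      ((hE A).continuousAt.add (hE' A).continuousAt).sub
        (continuousAt_const.div continuousAt_id hA0)
    refine (tendsto_mul_add_div hF W).congr fun s => ?_
    simp only [zetaG]
    ring

end WengRRZeta
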